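/- Let f be in the class F and let y_0, ..., y_N be generated by GOGM' with parameters t_i = (i+a)/a for a fixed a ≥ 2 (this instance is called OGM-a). Then for any 1 ≤ i ≤ N, f(y_i) − f(x_*) ≤ a·L·R² / (2 i (i + 2a − 1)). -/

import Mathlib

/-- The derivative of a differentiable function along a line. -/
theorem HasGradientAt.hasDerivAt_line {E : Type*} [NormedAddCommGroup E] [InnerProductSpace ℝ E]
    [CompleteSpace E] {f : E → ℝ} {f' : E → E} (hdiff : ∀ z, HasGradientAt f (f' z) z)
    (u v : E) (s : ℝ) :
    HasDerivAt (fun r : ℝ => f (u + r • v)) (inner ℝ (f' (u + s • v)) v) s := by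
  have h1 : HasDerivAt (fun r : ℝ => u + r • v) v s := by
    simpa using ((hasDerivAt_id s).smul_const v).const_add u
  have h2 := (hdiff (u + s • v)).hasFDerivAt.comp_hasDerivAt s h1
  simpa [Function.comp_def] using h2

/-- A function with `L`-Lipschitz gradient lies below its quadratic upper model. -/
theorem le_quadratic_of_lipschitz_gradient {E : Type*} [NormedAddCommGroup E]
    [InnerProductSpace ℝ E] [CompleteSpace E] {f : E → ℝ} {f' : E → E} {L : ℝ}
    (hdiff : ∀ z, HasGradientAt f (f' z) z)
    (hlip : ∀ z w, ‖f' z - f' w‖ ≤ L * ‖z - w‖) (u v : E) :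
    f (u + v) ≤ f u + inner ℝ (f' u) v + L / 2 * ‖v‖ ^ 2 := by
  let φ : ℝ → ℝ := fun s => f (u + s • v) - s * inner ℝ (f' u) v - L / 2 * ‖v‖ ^ 2 * s ^ 2
  have hφ (s : ℝ) : HasDerivAt φ
      (inner ℝ (f' (u + s • v)) v - inner ℝ (f' u) v - L * ‖v‖ ^ 2 * s) s := by
    have h1 := HasGradientAt.hasDerivAt_line hdiff u v s
    have h2 := (hasDerivAt_id s).mul_const (inner ℝ (f' u) v)
    have h3 := ((hasDerivAt_id s).pow 2).const_mul (L / 2 * ‖v‖ ^ 2)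
    refine ((h1.sub h2).sub h3).congr_deriv ?_
    simp only [id, one_mul, Nat.cast_ofNat]
    ring
  have hanti : AntitoneOn φ (Set.Icc 0 1) := by
    refine antitoneOn_of_deriv_nonpos (convex_Icc 0 1)
      (fun s _ => (hφ s).continuousAt.continuousWithinAt)
      (fun s _ => (hφ s).differentiableAt.differentiableWithinAt) fun s hs => ?_
    rw [interior_Icc] at hs
    rw [(hφ s).deriv, ← inner_sub_left]
    have h1 := real_inner_le_norm (f' (u + s • v) - f' u) v
    have h2 := hlip (u + s • v) u
    rw [add_sub_cancel_left, norm_smul, Real.norm_of_nonneg hs.1.le] at h2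
    nlinarith [mul_le_mul_of_nonneg_right h2 (norm_nonneg v)]
  have h := hanti (by simp) (by simp) (zero_le_one' ℝ)
  simp only [φ, one_smul, zero_smul, add_zero] at h
  linarith

/-- The gradient inequality for convex functions. -/
theorem ConvexOn.add_inner_gradient_le {E : Type*} [NormedAddCommGroup E]
    [InnerProductSpace ℝ E] [CompleteSpace E] {f : E → ℝ} {f' : E → E}
    (hconv : ConvexOn ℝ Set.univ f) (hdiff : ∀ z, HasGradientAt f (f' z) z) (u v : E) :
    f u + inner ℝ (f' u) (v - u) ≤ f v := by
  have hc : ConvexOn ℝ Set.univ (fun r : ℝ => f (u + r • (v - u))) := by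
    have h := hconv.comp_affineMap (AffineMap.lineMap (k := ℝ) u v)
    simpa [Function.comp_def, AffineMap.lineMap_apply, add_comm] using h
  have h0 := HasGradientAt.hasDerivAt_line hdiff u (v - u) 0
  have h := hc.le_slope_of_hasDerivAt (Set.mem_univ 0) (Set.mem_univ 1) zero_lt_one h0
  simp [slope_def_field] at h
  linarith

/-- The interpolation inequality for convex functions with `L`-Lipschitz gradient. -/
theorem ConvexOn.add_inner_add_sq_norm_gradient_sub_le {E : Type*} [NormedAddCommGroup E]
    [InnerProductSpace ℝ E] [CompleteSpace E] {f : E → ℝ} {f' : E → E} {L : ℝ} (hL : 0 < L)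
    (hconv : ConvexOn ℝ Set.univ f) (hdiff : ∀ z, HasGradientAt f (f' z) z)
    (hlip : ∀ z w, ‖f' z - f' w‖ ≤ L * ‖z - w‖) (u v : E) :
    f v + inner ℝ (f' v) (u - v) + 1 / (2 * L) * ‖f' u - f' v‖ ^ 2 ≤ f u := by
  have h1 := le_quadratic_of_lipschitz_gradient hdiff hlip u (-(1 / L) • (f' u - f' v))
  have h2 := hconv.add_inner_gradient_le hdiff v (u + -(1 / L) • (f' u - f' v))
  have h3 : L / 2 * ‖-(1 / L) • (f' u - f' v)‖ ^ 2 = 1 / (2 * L) * ‖f' u - f' v‖ ^ 2 := by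
    rw [norm_smul, mul_pow, Real.norm_eq_abs, sq_abs]
    field_simp
  have h4 : inner ℝ (f' v) (-(1 / L) • (f' u - f' v))
      - inner ℝ (f' u) (-(1 / L) • (f' u - f' v)) = 1 / L * ‖f' u - f' v‖ ^ 2 := by
    rw [← inner_sub_left, inner_smul_right, ← neg_sub (f' u), inner_neg_left,
      real_inner_self_eq_norm_sq]
    ring
  have h5 : inner ℝ (f' v) (u + -(1 / L) • (f' u - f' v) - v)
      = inner ℝ (f' v) (u - v) + inner ℝ (f' v) (-(1 / L) • (f' u - f' v)) := by
    rw [← inner_add_right]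
    congr 1
    abel
  have h6 : 1 / L * ‖f' u - f' v‖ ^ 2 = 2 * (1 / (2 * L) * ‖f' u - f' v‖ ^ 2) := by
    field_simp
  linarith

/-- The potential of the optimized gradient method does not increase in one step. Here `S` is the
sum of the previous weights, `τ` the next weight, `p` the previous point, `q` the next point and
`z` the auxiliary point. -/
theorem ogm_potential_step {E : Type*} [NormedAddCommGroup E]
    [InnerProductSpace ℝ E] [CompleteSpace E] {f : E → ℝ} {f' : E → E} {L : ℝ} (hL : 0 < L)
    (hconv : ConvexOn ℝ Set.univ f) (hdiff : ∀ z, HasGradientAt f (f' z) z)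
    (hlip : ∀ z w, ‖f' z - f' w‖ ≤ L * ‖z - w‖) {xs : E} (hxs : f' xs = 0)
    {S τ : ℝ} (hS : 0 ≤ S) (hτ : 0 ≤ τ) (hτS : τ ^ 2 ≤ S + τ) {p q z : E}
    (hq : (S + τ) • q = S • (p - (1 / L) • f' p) + τ • z) :
    2 * (S + τ) * (f q - f xs - 1 / (2 * L) * ‖f' q‖ ^ 2)
        + L / 2 * ‖z - (2 * τ / L) • f' q - xs‖ ^ 2 ≤
      2 * S * (f p - f xs - 1 / (2 * L) * ‖f' p‖ ^ 2) + L / 2 * ‖z - xs‖ ^ 2 := by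
  have hA := hconv.add_inner_add_sq_norm_gradient_sub_le hL hdiff hlip p q
  have hB := hconv.add_inner_add_sq_norm_gradient_sub_le hL hdiff hlip xs q
  rw [hxs, zero_sub, norm_neg] at hB
  have hz : ‖z - (2 * τ / L) • f' q - xs‖ ^ 2 = ‖z - xs‖ ^ 2
      - 2 * (2 * τ / L) * inner ℝ (f' q) (z - xs) + (2 * τ / L) ^ 2 * ‖f' q‖ ^ 2 := by
    rw [sub_right_comm, norm_sub_sq_real, inner_smul_right, real_inner_comm, norm_smul, mul_pow,
      Real.norm_eq_abs, sq_abs]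
    ring
  have hi := congrArg (inner ℝ (f' q)) hq
  simp only [inner_add_right, inner_sub_right, inner_smul_right] at hi hA hB hz
  rw [norm_sub_sq_real, real_inner_comm (f' q) (f' p)] at hA
  rw [hz]
  have hA' := mul_le_mul_of_nonneg_left hA (mul_nonneg zero_le_two hS)
  have hB' := mul_le_mul_of_nonneg_left hB (mul_nonneg zero_le_two hτ)
  have hC := mul_le_mul_of_nonneg_right hτS (by positivity : 0 ≤ 2 / L * ‖f' q‖ ^ 2)
  have hL' : L / 2 * (‖z - xs‖ ^ 2 - 2 * (2 * τ / L) * (inner ℝ (f' q) z - inner ℝ (f' q) xs)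
      + (2 * τ / L) ^ 2 * ‖f' q‖ ^ 2) = L / 2 * ‖z - xs‖ ^ 2
      - 2 * τ * (inner ℝ (f' q) z - inner ℝ (f' q) xs) + τ ^ 2 * (2 / L * ‖f' q‖ ^ 2) := by
    field_simp
  have hinv : 1 / (2 * L) = 1 / L / 2 := by field_simp
  have hinv2 : 2 / L = 2 * (1 / L) := by ring
  rw [hL']
  rw [hinv] at hA' hB' ⊢
  rw [hinv2] at hC ⊢
  linear_combination hA' + hB' + hC + 2 * hi

theorem stmt_9 {d : ℕ} (L R : ℝ) (hL : 0 < L) (hR : 0 < R)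
    (f : EuclideanSpace ℝ (Fin d) → ℝ)
    (f' : EuclideanSpace ℝ (Fin d) → EuclideanSpace ℝ (Fin d))
    (hconv : ConvexOn ℝ Set.univ f)
    (hdiff : ∀ z, HasGradientAt f (f' z) z)
    (hlip : ∀ z w, ‖f' z - f' w‖ ≤ L * ‖z - w‖)
    (xs : EuclideanSpace ℝ (Fin d)) (hmin : ∀ z, f xs ≤ f z)
    (N : ℕ) (a : ℝ) (ha : 2 ≤ a)
    (t T : ℕ → ℝ)
    (ht : ∀ i, t i = ((i : ℝ) + a) / a)
    (hT : ∀ i, T i = ∑ l ∈ Finset.range (i + 1), t l)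
    (x y : ℕ → EuclideanSpace ℝ (Fin d)) (x0 : EuclideanSpace ℝ (Fin d))
    (hx0 : x 0 = x0) (hy0 : y 0 = x0) (hinit : ‖x0 - xs‖ ≤ R)
    (hy : ∀ i, i < N → y (i + 1) = x i - (1 / L) • f' (x i))
    (hx : ∀ i, i < N → x (i + 1) = y (i + 1)
        + ((T i - t i) * t (i + 1) / (t i * T (i + 1))) • (y (i + 1) - y i)
        + ((2 * t i ^ 2 - T i) * t (i + 1) / (t i * T (i + 1))) • (y (i + 1) - x i)) :
    ∀ i, i < N → f (y (i + 1)) - f xs ≤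
      a * L * R ^ 2 / (2 * ((i : ℝ) + 1) * (((i : ℝ) + 1) + 2 * a - 1)) := by
  have ha0 : 0 < a := by linarith
  have hxs : f' xs = 0 := by
    have hloc : IsLocalMin f xs := Filter.Eventually.of_forall hmin
    have h := hloc.hasFDerivAt_eq_zero (hdiff xs).hasFDerivAt
    simpa using h
  have hT' (i : ℕ) : T i = ((i : ℝ) + 1) * (i + 2 * a) / (2 * a) := by
    induction i with
    | zero => rw [hT, Finset.sum_range_one, ht]; push_cast; field_simp; ring
    | succ k ih =>
      rw [hT, Finset.sum_range_succ, ← hT, ih, ht]; push_cast; field_simp; ring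
  have hTs (i : ℕ) : T (i + 1) = T i + t (i + 1) := by
    rw [hT, Finset.sum_range_succ, ← hT]
  have htpos (i : ℕ) : 0 < t i := by rw [ht]; positivity
  have hTpos (i : ℕ) : 0 < T i := by rw [hT']; positivity
  have htT (i : ℕ) : t i ^ 2 ≤ T i := by
    rw [ht, hT', div_pow, div_le_div_iff₀ (by positivity) (by positivity)]
    have hi : (0 : ℝ) ≤ i := i.cast_nonneg
    have h : 2 * ((i : ℝ) + a) ^ 2 ≤ (i + 1) * (i + 2 * a) * a := by
      nlinarith [mul_nonneg (sq_nonneg (i : ℝ)) (sub_nonneg.2 ha),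
        mul_nonneg (mul_nonneg hi ha0.le) (sub_nonneg.2 ha), mul_nonneg hi ha0.le]
    nlinarith [mul_le_mul_of_nonneg_right h ha0.le]
  have key (i : ℕ) (hi : i < N) : ∃ z, T i • x i = (T i - t i) • y i + t i • z ∧
      2 * T i * (f (x i) - f xs - 1 / (2 * L) * ‖f' (x i)‖ ^ 2)
        + L / 2 * ‖z - (2 * t i / L) • f' (x i) - xs‖ ^ 2 ≤ L / 2 * R ^ 2 := by
    induction i with
    | zero =>
      have hT0 : T 0 = 0 + t 0 := by rw [hT, Finset.sum_range_one, zero_add]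
      refine ⟨x 0, ?_, ?_⟩
      · rw [hT0]; simp
      · have h := ogm_potential_step hL hconv hdiff hlip hxs le_rfl (htpos 0).le
          (hT0 ▸ htT 0) (p := x 0) (q := x 0) (z := x 0) (by simp)
        rw [← hT0] at h
        have h2 : ‖x 0 - xs‖ ^ 2 ≤ R ^ 2 := by rw [hx0]; gcongr
        nlinarith
    | succ k ih =>
      obtain ⟨z, hz, hU⟩ := ih (by omega)
      have hyk := hy k (by omega)
      have hq : (T k + t (k + 1)) • x (k + 1) = T k • (x k - (1 / L) • f' (x k))
          + t (k + 1) • (z - (2 * t k / L) • f' (x k)) := by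
        have hzv : z = (1 / t k) • (T k • x k - (T k - t k) • y k) := by
          rw [hz, add_sub_cancel_left, smul_smul, one_div_mul_cancel (htpos k).ne', one_smul]
        have := (htpos k).ne'
        have := (hTpos (k + 1)).ne'
        rw [← hTs, hx k (by omega), hyk, hzv]
        have hs : t (k + 1) = T (k + 1) - T k := by rw [hTs]; ring
        rw [hs]
        match_scalars <;> field_simp <;> ring
      refine ⟨z - (2 * t k / L) • f' (x k), ?_, ?_⟩
      · rw [hyk, hTs, hq, add_sub_cancel_right]
      · have h := ogm_potential_step hL hconv hdiff hlip hxs (hTpos k).le (htpos (k + 1)).le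
          (hTs k ▸ htT (k + 1)) hq
        rw [← hTs] at h
        exact h.trans hU
  intro i hi
  obtain ⟨z, -, hU⟩ := key i hi
  have hdesc : f (y (i + 1)) ≤ f (x i) - 1 / (2 * L) * ‖f' (x i)‖ ^ 2 := by
    have h := le_quadratic_of_lipschitz_gradient hdiff hlip (x i) (-((1 / L) • f' (x i)))
    rw [hy i hi, sub_eq_add_neg]
    refine h.trans_eq ?_
    rw [inner_neg_right, inner_smul_right, real_inner_self_eq_norm_sq, norm_neg, norm_smul, mul_pow,
      Real.norm_eq_abs, sq_abs]
    field_simp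
    ring
  have hmain : 2 * T i * (f (y (i + 1)) - f xs) ≤ L / 2 * R ^ 2 := by
    have h1 : 2 * T i * (f (y (i + 1)) - f xs)
        ≤ 2 * T i * (f (x i) - f xs - 1 / (2 * L) * ‖f' (x i)‖ ^ 2) :=
      mul_le_mul_of_nonneg_left (by linarith) (by linarith [hTpos i])
    have h2 : 0 ≤ L / 2 * ‖z - (2 * t i / L) • f' (x i) - xs‖ ^ 2 := by positivity
    linarith
  have hbound : a * L * R ^ 2 / (2 * ((i : ℝ) + 1) * (((i : ℝ) + 1) + 2 * a - 1))
      = L / 2 * R ^ 2 / (2 * T i) := by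
    have h : (i : ℝ) + 1 + 2 * a - 1 = i + 2 * a := by ring
    rw [hT', h]
    field_simp
  rw [hbound, le_div_iff₀ (by linarith [hTpos i])]
  linarith
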